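/- arXiv:2211.08750 — 3 statements merged into one kernel-verified Lean document; each statement's English description precedes it below -/
import Mathlib

section
/- Let a₁, a₂, a₃ be real numbers. With J₁ = x₂p₃ − x₃p₂, J₂ = x₃p₁ − x₁p₃, J₃ = x₁p₂ − x₂p₁, define the Neumann integrals H = a₁J₁² + a₂J₂² + a₃J₃² + a₂a₃x₁² + a₁a₃x₂² + a₁a₂x₃² and K = J₁²+J₂²+J₃² − a₁x₁² − a₂x₂² − a₃x₃². Then {H, K}_S = 0 at every point of the constraint surface T*S² (where x₁²+x₂²+x₃² = 1 and x₁p₁+x₂p₂+x₃p₃ = 0). -/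
noncomputable section

/-- Phase space T*ℝ³ = ℝ³ × ℝ³ with coordinates (x, p). -/
abbrev Phase : Type := (Fin 3 → ℝ) × (Fin 3 → ℝ)

/-- Canonical Poisson bracket on ℝ³ × ℝ³:
{f,g} = Σᵢ (∂f/∂xᵢ ∂g/∂pᵢ − ∂f/∂pᵢ ∂g/∂xᵢ). -/
noncomputable def pb (f g : Phase → ℝ) (z : Phase) : ℝ :=
  ∑ i : Fin 3,
    (fderiv ℝ f z (Pi.single i 1, 0) * fderiv ℝ g z (0, Pi.single i 1) -
     fderiv ℝ f z (0, Pi.single i 1) * fderiv ℝ g z (Pi.single i 1, 0))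

/-- Dirac bracket associated with constraints F₁, F₂:
{f,g}_D = {f,g} − ({F₁,f}{F₂,g} − {F₁,g}{F₂,f})/{F₁,F₂}. -/
noncomputable def dirac (F₁ F₂ f g : Phase → ℝ) (z : Phase) : ℝ :=
  pb f g z - (pb F₁ f z * pb F₂ g z - pb F₁ g z * pb F₂ f z) / pb F₁ F₂ z
/-- Sphere constraint F₁ = x₁² + x₂² + x₃² − 1. -/
def sphereF₁ : Phase → ℝ := fun z => z.1 0 ^ 2 + z.1 1 ^ 2 + z.1 2 ^ 2 - 1

/-- Sphere constraint F₂ = x₁p₁ + x₂p₂ + x₃p₃. -/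
def sphereF₂ : Phase → ℝ := fun z => z.1 0 * z.2 0 + z.1 1 * z.2 1 + z.1 2 * z.2 2

/-- Sphere Dirac bracket {·,·}_S. -/
noncomputable def diracS (f g : Phase → ℝ) (z : Phase) : ℝ :=
  dirac sphereF₁ sphereF₂ f g z

/-- Angular momentum J₁ = x₂p₃ − x₃p₂. -/
noncomputable def J1 : Phase → ℝ := fun z => z.1 1 * z.2 2 - z.1 2 * z.2 1
/-- Angular momentum J₂ = x₃p₁ − x₁p₃. -/
noncomputable def J2 : Phase → ℝ := fun z => z.1 2 * z.2 0 - z.1 0 * z.2 2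
/-- Angular momentum J₃ = x₁p₂ − x₂p₁. -/
noncomputable def J3 : Phase → ℝ := fun z => z.1 0 * z.2 1 - z.1 1 * z.2 0

lemma hasFDerivAt_position (i : Fin 3) (z : Phase) :
    HasFDerivAt (fun w : Phase => w.1 i)
      ((ContinuousLinearMap.proj i).comp (ContinuousLinearMap.fst ℝ (Fin 3 → ℝ) (Fin 3 → ℝ))) z :=
  ((ContinuousLinearMap.proj i : (Fin 3 → ℝ) →L[ℝ] ℝ).comp
    (ContinuousLinearMap.fst ℝ (Fin 3 → ℝ) (Fin 3 → ℝ))).hasFDerivAt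

lemma hasFDerivAt_momentum (i : Fin 3) (z : Phase) :
    HasFDerivAt (fun w : Phase => w.2 i)
      ((ContinuousLinearMap.proj i).comp (ContinuousLinearMap.snd ℝ (Fin 3 → ℝ) (Fin 3 → ℝ))) z :=
  ((ContinuousLinearMap.proj i : (Fin 3 → ℝ) →L[ℝ] ℝ).comp
    (ContinuousLinearMap.snd ℝ (Fin 3 → ℝ) (Fin 3 → ℝ))).hasFDerivAt

/-- A quadratic form, diagonal in the angular momenta and in the positions. -/
def diagQuadratic (b c : Fin 3 → ℝ) : Phase → ℝ := fun w =>
  b 0 * J1 w ^ 2 + b 1 * J2 w ^ 2 + b 2 * J3 w ^ 2 +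
    c 0 * w.1 0 ^ 2 + c 1 * w.1 1 ^ 2 + c 2 * w.1 2 ^ 2

lemma fderiv_diagQuadratic_apply (b c : Fin 3 → ℝ) (z v : Phase) :
    fderiv ℝ (diagQuadratic b c) z v =
      2 * (b 0 * J1 z * (v.1 1 * z.2 2 + z.1 1 * v.2 2 - v.1 2 * z.2 1 - z.1 2 * v.2 1) +
        b 1 * J2 z * (v.1 2 * z.2 0 + z.1 2 * v.2 0 - v.1 0 * z.2 2 - z.1 0 * v.2 2) +
        b 2 * J3 z * (v.1 0 * z.2 1 + z.1 0 * v.2 1 - v.1 1 * z.2 0 - z.1 1 * v.2 0) +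
        c 0 * z.1 0 * v.1 0 + c 1 * z.1 1 * v.1 1 + c 2 * z.1 2 * v.1 2) := by
  have hJ (i j : Fin 3) := ((hasFDerivAt_position i z).mul (hasFDerivAt_momentum j z)).sub
    ((hasFDerivAt_position j z).mul (hasFDerivAt_momentum i z))
  have h : HasFDerivAt (diagQuadratic b c) _ z :=
    ((((((((hJ 1 2).pow 2).const_mul (b 0)).add (((hJ 2 0).pow 2).const_mul (b 1))).add
      (((hJ 0 1).pow 2).const_mul (b 2))).add
      (((hasFDerivAt_position 0 z).pow 2).const_mul (c 0))).add
      (((hasFDerivAt_position 1 z).pow 2).const_mul (c 1))).add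
      (((hasFDerivAt_position 2 z).pow 2).const_mul (c 2)))
  rw [h.fderiv]
  simp [J1, J2, J3]
  ring

lemma fderiv_sphereF₁_apply (z v : Phase) :
    fderiv ℝ sphereF₁ z v = 2 * (z.1 0 * v.1 0 + z.1 1 * v.1 1 + z.1 2 * v.1 2) := by
  have h : HasFDerivAt sphereF₁ _ z :=
    ((((hasFDerivAt_position 0 z).pow 2).add ((hasFDerivAt_position 1 z).pow 2)).add
      ((hasFDerivAt_position 2 z).pow 2)).sub_const 1
  rw [h.fderiv]
  simp
  ring

/-- The radius Poisson-commutes with the angular momenta and the positions. -/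
lemma pb_sphereF₁_diagQuadratic (b c : Fin 3 → ℝ) (z : Phase) :
    pb sphereF₁ (diagQuadratic b c) z = 0 := by
  simp [pb, Fin.sum_univ_three, fderiv_sphereF₁_apply, fderiv_diagQuadratic_apply, J1, J2, J3]
  ring

/-- The Neumann integrals are in involution already for the canonical bracket. -/
lemma pb_neumann (a₁ a₂ a₃ : ℝ) (z : Phase) :
    pb (diagQuadratic ![a₁, a₂, a₃] ![a₂ * a₃, a₁ * a₃, a₁ * a₂])
      (diagQuadratic ![1, 1, 1] ![-a₁, -a₂, -a₃]) z = 0 := by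
  simp [pb, Fin.sum_univ_three, fderiv_diagQuadratic_apply, J1, J2, J3]
  ring

/-- the Neumann integrals H and K are in involution with respect to
the sphere Dirac bracket on T*S². -/
theorem neumann_sphere_involution
    (a₁ a₂ a₃ : ℝ) (z : Phase)
    (h1 : z.1 0 ^ 2 + z.1 1 ^ 2 + z.1 2 ^ 2 = 1)
    (h2 : z.1 0 * z.2 0 + z.1 1 * z.2 1 + z.1 2 * z.2 2 = 0) :
    diracS
      (fun w => a₁ * J1 w ^ 2 + a₂ * J2 w ^ 2 + a₃ * J3 w ^ 2 +
        a₂ * a₃ * w.1 0 ^ 2 + a₁ * a₃ * w.1 1 ^ 2 + a₁ * a₂ * w.1 2 ^ 2)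
      (fun w => J1 w ^ 2 + J2 w ^ 2 + J3 w ^ 2 -
        a₁ * w.1 0 ^ 2 - a₂ * w.1 1 ^ 2 - a₃ * w.1 2 ^ 2) z = 0 := by
  have hH : (fun w : Phase => a₁ * J1 w ^ 2 + a₂ * J2 w ^ 2 + a₃ * J3 w ^ 2 +
      a₂ * a₃ * w.1 0 ^ 2 + a₁ * a₃ * w.1 1 ^ 2 + a₁ * a₂ * w.1 2 ^ 2) =
      diagQuadratic ![a₁, a₂, a₃] ![a₂ * a₃, a₁ * a₃, a₁ * a₂] := by
    ext w
    simp [diagQuadratic]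
  have hK : (fun w : Phase => J1 w ^ 2 + J2 w ^ 2 + J3 w ^ 2 -
      a₁ * w.1 0 ^ 2 - a₂ * w.1 1 ^ 2 - a₃ * w.1 2 ^ 2) =
      diagQuadratic ![1, 1, 1] ![-a₁, -a₂, -a₃] := by
    ext w
    simp [diagQuadratic]
    ring
  rw [hH, hK]
  simp [diracS, dirac, pb_neumann, pb_sphereF₁_diagQuadratic]
end
end

section
/- Let a, b be real numbers. With J₁ = x₂p₃ − x₃p₂, J₂ = x₃p₁ − x₁p₃, J₃ = x₁p₂ − x₂p₁, define the Gaffet system with vorticity: H = J₁² + J₂² + J₃² + a²/(x₁x₂x₃)^{2/3} + b²(x₂² + x₃²)/(x₂² − x₃²)², and K = K₆ + K₄ + K₂ + K₀ where K₆ = (J₁J₂J₃)², K₄ = 2b²x₂x₃J₂J₃(J₁²x₁² + 2J₂J₃x₂x₃)/(x₂² − x₃²)² − 2a²J₁J₂J₃(J₁x₂x₃ + J₂x₁x₃ + J₃x₁x₂)/(x₁x₂x₃)^{2/3}, K₂ = a⁴(J₁x₂x₃ + J₂x₁x₃ + J₃x₁x₂)²/(x₁x₂x₃)^{4/3} + b⁴x₁²x₂²x₃²(J₁²x₁²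 + 8J₂J₃x₂x₃)/(x₂² − x₃²)⁴ − 2a²b²(J₁²x₁²x₂x₃ + x₁³(J₂x₃ + J₃x₂)J₁ − 2J₂J₃(x₁²(x₂² + x₃²) − 2x₂²x₃²))·(x₂x₃)^{1/3}/((x₂² − x₃²)²·x₁^{2/3}), and K₀ = 4a⁴b²(x₁² − x₂²)(x₁² − x₃²)(x₂x₃)^{2/3}/((x₂² − x₃²)²·x₁^{4/3}) + 4a²b⁴(x₁x₂x₃)^{4/3}(x₁²(x₂² + x₃²) − 2x₂²x₃²)/(x₂² − x₃²)⁴ + 4b⁶(x₁x₂x₃)⁴/(x₂² − x₃²)⁶. Then {H, K}_S = 0 at every point of the constraint surface T*S² (where x₁²+x₂²+x₃² = 1 and x₁p₁+x₂p₂+x₃p₃ = 0) with x₁ > 0, x₂ > 0, x₃ > 0 and x₂² ≠ x₃². -/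
noncomputable section

/-- Sextic part K₆ = (J₁J₂J₃)². -/
noncomputable def GK6 : Phase → ℝ := fun w => (J1 w * J2 w * J3 w) ^ 2

/-- Quartic part K₄ of the sextic Gaffet invariant. -/
noncomputable def GK4 (a b : ℝ) : Phase → ℝ := fun w =>
  2 * b ^ 2 * w.1 1 * w.1 2 * J2 w * J3 w *
      (J1 w ^ 2 * w.1 0 ^ 2 + 2 * J2 w * J3 w * w.1 1 * w.1 2) /
    (w.1 1 ^ 2 - w.1 2 ^ 2) ^ 2 -
  2 * a ^ 2 * J1 w * J2 w * J3 w *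
      (J1 w * w.1 1 * w.1 2 + J2 w * w.1 0 * w.1 2 + J3 w * w.1 0 * w.1 1) /
    (w.1 0 * w.1 1 * w.1 2) ^ ((2 : ℝ) / 3)

/-- Quadratic part K₂ of the sextic Gaffet invariant. -/
noncomputable def GK2 (a b : ℝ) : Phase → ℝ := fun w =>
  a ^ 4 * (J1 w * w.1 1 * w.1 2 + J2 w * w.1 0 * w.1 2 + J3 w * w.1 0 * w.1 1) ^ 2 /
    (w.1 0 * w.1 1 * w.1 2) ^ ((4 : ℝ) / 3) +
  b ^ 4 * w.1 0 ^ 2 * w.1 1 ^ 2 * w.1 2 ^ 2 *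
      (J1 w ^ 2 * w.1 0 ^ 2 + 8 * J2 w * J3 w * w.1 1 * w.1 2) /
    (w.1 1 ^ 2 - w.1 2 ^ 2) ^ 4 -
  2 * a ^ 2 * b ^ 2 *
      (J1 w ^ 2 * w.1 0 ^ 2 * w.1 1 * w.1 2 +
       w.1 0 ^ 3 * (J2 w * w.1 2 + J3 w * w.1 1) * J1 w -
       2 * J2 w * J3 w * (w.1 0 ^ 2 * (w.1 1 ^ 2 + w.1 2 ^ 2) -
         2 * w.1 1 ^ 2 * w.1 2 ^ 2)) *
      (w.1 1 * w.1 2) ^ ((1 : ℝ) / 3) /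
    ((w.1 1 ^ 2 - w.1 2 ^ 2) ^ 2 * w.1 0 ^ ((2 : ℝ) / 3))

/-- Momentum-free part K₀ of the sextic Gaffet invariant. -/
noncomputable def GK0 (a b : ℝ) : Phase → ℝ := fun w =>
  4 * a ^ 4 * b ^ 2 * (w.1 0 ^ 2 - w.1 1 ^ 2) * (w.1 0 ^ 2 - w.1 2 ^ 2) *
      (w.1 1 * w.1 2) ^ ((2 : ℝ) / 3) /
    ((w.1 1 ^ 2 - w.1 2 ^ 2) ^ 2 * w.1 0 ^ ((4 : ℝ) / 3)) +
  4 * a ^ 2 * b ^ 4 * (w.1 0 * w.1 1 * w.1 2) ^ ((4 : ℝ) / 3) *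
      (w.1 0 ^ 2 * (w.1 1 ^ 2 + w.1 2 ^ 2) - 2 * w.1 1 ^ 2 * w.1 2 ^ 2) /
    (w.1 1 ^ 2 - w.1 2 ^ 2) ^ 4 +
  4 * b ^ 6 * (w.1 0 * w.1 1 * w.1 2) ^ 4 / (w.1 1 ^ 2 - w.1 2 ^ 2) ^ 6

/-- The coordinate covector `dxᵢ`. -/
def dx (i : Fin 3) : Phase →L[ℝ] ℝ :=
  (ContinuousLinearMap.proj i).comp (ContinuousLinearMap.fst ℝ (Fin 3 → ℝ) (Fin 3 → ℝ))

/-- The coordinate covector `dpᵢ`. -/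
def dp (i : Fin 3) : Phase →L[ℝ] ℝ :=
  (ContinuousLinearMap.proj i).comp (ContinuousLinearMap.snd ℝ (Fin 3 → ℝ) (Fin 3 → ℝ))

@[simp] lemma dx_apply (i : Fin 3) (v : Phase) : dx i v = v.1 i := rfl

@[simp] lemma dp_apply (i : Fin 3) (v : Phase) : dp i v = v.2 i := rfl

lemma hasFDerivAt_x (i : Fin 3) (z : Phase) : HasFDerivAt (fun w : Phase => w.1 i) (dx i) z :=
  (dx i).hasFDerivAt

lemma hasFDerivAt_p (i : Fin 3) (z : Phase) : HasFDerivAt (fun w : Phase => w.2 i) (dp i) z :=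
  (dp i).hasFDerivAt

/-- The differential of `xᵢpⱼ − xⱼpᵢ`. -/
def dJ (i j : Fin 3) (z : Phase) : Phase →L[ℝ] ℝ :=
  z.1 i • dp j + z.2 j • dx i - (z.1 j • dp i + z.2 i • dx j)

lemma hasFDerivAt_J1 (z : Phase) : HasFDerivAt J1 (dJ 1 2 z) z :=
  ((hasFDerivAt_x 1 z).mul (hasFDerivAt_p 2 z)).sub ((hasFDerivAt_x 2 z).mul (hasFDerivAt_p 1 z))

lemma hasFDerivAt_J2 (z : Phase) : HasFDerivAt J2 (dJ 2 0 z) z :=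
  ((hasFDerivAt_x 2 z).mul (hasFDerivAt_p 0 z)).sub ((hasFDerivAt_x 0 z).mul (hasFDerivAt_p 2 z))

lemma hasFDerivAt_J3 (z : Phase) : HasFDerivAt J3 (dJ 0 1 z) z :=
  ((hasFDerivAt_x 0 z).mul (hasFDerivAt_p 1 z)).sub ((hasFDerivAt_x 1 z).mul (hasFDerivAt_p 0 z))

lemma hasFDerivAt_sphereF₁ (z : Phase) :
    HasFDerivAt sphereF₁
      ((2 * z.1 0) • dx 0 + (2 * z.1 1) • dx 1 + (2 * z.1 2) • dx 2) z := by
  have h := ((((hasFDerivAt_x 0 z).pow 2).add ((hasFDerivAt_x 1 z).pow 2)).add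
    ((hasFDerivAt_x 2 z).pow 2)).sub_const 1
  refine h.congr_fderiv ?_
  ext v <;> simp

/-- A covector written in terms of `dJ₁, dJ₂, dJ₃, dx₁, dx₂, dx₃`. -/
def covec (A B : Fin 3 → ℝ) (z : Phase) : Phase →L[ℝ] ℝ :=
  A 0 • dJ 1 2 z + A 1 • dJ 2 0 z + A 2 • dJ 0 1 z + B 0 • dx 0 + B 1 • dx 1 + B 2 • dx 2

/-- On functions of `x` and `J`, the sphere Dirac bracket is the Lie–Poisson bracket of `e(3)`. -/
lemma diracS_of_hasFDerivAt {f g : Phase → ℝ} {z : Phase} {A B C D : Fin 3 → ℝ}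
    (hf : HasFDerivAt f (covec A B z) z) (hg : HasFDerivAt g (covec C D z) z) :
    diracS f g z =
      J1 z * (A 1 * C 2 - A 2 * C 1) + J2 z * (A 2 * C 0 - A 0 * C 2) +
        J3 z * (A 0 * C 1 - A 1 * C 0) +
      z.1 0 * (A 1 * D 2 - A 2 * D 1 + B 1 * C 2 - B 2 * C 1) +
      z.1 1 * (A 2 * D 0 - A 0 * D 2 + B 2 * C 0 - B 0 * C 2) +
      z.1 2 * (A 0 * D 1 - A 1 * D 0 + B 0 * C 1 - B 1 * C 0) := by
  have h₁ : ∀ {k : Phase → ℝ} {P Q : Fin 3 → ℝ}, HasFDerivAt k (covec P Q z) z →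
      pb sphereF₁ k z = 0 := by
    intro k P Q hk
    simp only [pb, hk.fderiv, (hasFDerivAt_sphereF₁ z).fderiv, Fin.sum_univ_three]
    simp [covec, dJ]
    ring
  rw [diracS, dirac, h₁ hf, h₁ hg]
  simp only [pb, hf.fderiv, hg.fderiv, Fin.sum_univ_three]
  simp [covec, dJ, J1, J2, J3]
  ring

/-- The potential `a² / (x₁x₂x₃)^{2/3}`. -/
def potA (a : ℝ) (w : Phase) : ℝ := a ^ 2 / (w.1 0 * w.1 1 * w.1 2) ^ ((2 : ℝ) / 3)

/-- The vorticity factor `b² / (x₂² − x₃²)²`. -/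
def potB (b : ℝ) (w : Phase) : ℝ := b ^ 2 / (w.1 1 ^ 2 - w.1 2 ^ 2) ^ 2

lemma hasFDerivAt_potA (a : ℝ) {z : Phase} (h0 : 0 < z.1 0) (h1 : 0 < z.1 1) (h2 : 0 < z.1 2) :
    HasFDerivAt (potA a) ((-(2 / 3) * potA a z / (z.1 0 * z.1 1 * z.1 2)) •
      ((z.1 1 * z.1 2) • dx 0 + (z.1 0 * z.1 2) • dx 1 + (z.1 0 * z.1 1) • dx 2)) z := by
  have hX : 0 < z.1 0 * z.1 1 * z.1 2 := by positivity
  have hm := ((hasFDerivAt_x 0 z).mul (hasFDerivAt_x 1 z)).mul (hasFDerivAt_x 2 z)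
  have h := (hm.rpow_const (p := -(2 / 3 : ℝ)) (Or.inl hX.ne')).const_mul (a ^ 2)
  have he : potA a =ᶠ[nhds z]
      fun w => a ^ 2 * (w.1 0 * w.1 1 * w.1 2) ^ (-(2 / 3 : ℝ)) := by
    filter_upwards [hm.continuousAt.eventually (lt_mem_nhds hX)] with w hw
    have hw' : 0 < w.1 0 * w.1 1 * w.1 2 := hw
    rw [potA, Real.rpow_neg hw'.le, div_eq_mul_inv]
  refine (h.congr_of_eventuallyEq he).congr_fderiv ?_
  rw [potA, div_eq_mul_inv (a ^ 2), ← Real.rpow_neg hX.le]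
  ext v <;> simp [Real.rpow_sub_one hX.ne']
  ring

lemma hasFDerivAt_potB (b : ℝ) {z : Phase} (h : z.1 1 ^ 2 ≠ z.1 2 ^ 2) :
    HasFDerivAt (potB b) ((-4 * potB b z / (z.1 1 ^ 2 - z.1 2 ^ 2)) •
      (z.1 1 • dx 1 - z.1 2 • dx 2)) z := by
  have hd : z.1 1 ^ 2 - z.1 2 ^ 2 ≠ 0 := sub_ne_zero.mpr h
  have hm := (((hasFDerivAt_x 1 z).pow 2).sub ((hasFDerivAt_x 2 z).pow 2)).pow 2
  have h := ((hasDerivAt_inv (pow_ne_zero 2 hd)).comp_hasFDerivAt z hm).const_mul (b ^ 2)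
  refine h.congr_fderiv ?_
  ext v <;> simp [potB]
  field_simp
  ring

/-- `H` as a polynomial in `J`, `x`, `α = a² / (x₁x₂x₃)^{2/3}` and `u = b² / (x₂² − x₃²)²`. -/
def polyH (j1 j2 j3 x2 x3 α u : ℝ) : ℝ :=
  j1 ^ 2 + j2 ^ 2 + j3 ^ 2 + α + u * (x2 ^ 2 + x3 ^ 2)

/-- `K` as a polynomial in `J`, `x`, `α = a² / (x₁x₂x₃)^{2/3}` and `u = b² / (x₂² − x₃²)²`. -/
def polyK (j1 j2 j3 x1 x2 x3 α u : ℝ) : ℝ :=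
  (j1 * j2 * j3 - α * (j1 * x2 * x3 + j2 * x1 * x3 + j3 * x1 * x2)) ^ 2 +
  2 * (u * (x2 * x3 * (j2 * j3 * (j1 ^ 2 * x1 ^ 2 + 2 * (j2 * j3 * (x2 * x3)))))) +
  u ^ 2 * ((x1 * x2 * x3) ^ 2 * (j1 ^ 2 * x1 ^ 2 + 8 * (j2 * j3 * (x2 * x3)))) -
  2 * (α * u * (x2 * x3 * (j1 ^ 2 * x1 ^ 2 * (x2 * x3) + x1 ^ 3 * ((j2 * x3 + j3 * x2) * j1) -
    2 * (j2 * j3 * (x1 ^ 2 * (x2 ^ 2 + x3 ^ 2) - 2 * (x2 * x3) ^ 2))))) +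
  4 * (α ^ 2 * u * ((x1 ^ 2 - x2 ^ 2) * (x1 ^ 2 - x3 ^ 2) * (x2 * x3) ^ 2)) +
  4 * (α * u ^ 2 * ((x1 * x2 * x3) ^ 2 * (x1 ^ 2 * (x2 ^ 2 + x3 ^ 2) - 2 * (x2 * x3) ^ 2))) +
  4 * (u ^ 3 * (x1 * x2 * x3) ^ 4)

lemma cube_rpow_div_three {t : ℝ} (ht : 0 < t) (n : ℕ) :
    (t ^ 3) ^ ((n : ℝ) / 3) = t ^ n := by
  rw [← Real.rpow_natCast t 3, ← Real.rpow_mul ht.le, ← Real.rpow_natCast t n]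
  congr 1
  push_cast
  ring

lemma exists_pos_cube_eq {x : ℝ} (hx : 0 < x) : ∃ t : ℝ, 0 < t ∧ t ^ 3 = x :=
  ⟨x ^ ((1 : ℝ) / 3), by positivity, by
    rw [← Real.rpow_natCast, ← Real.rpow_mul hx.le]; norm_num⟩

lemma GK_eq_polyK (a b : ℝ) {w : Phase} (h0 : 0 < w.1 0) (h1 : 0 < w.1 1) (h2 : 0 < w.1 2) :
    GK6 w + GK4 a b w + GK2 a b w + GK0 a b w =
      polyK (J1 w) (J2 w) (J3 w) (w.1 0) (w.1 1) (w.1 2) (potA a w) (potB b w) := by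
  simp only [GK6, GK4, GK2, GK0, polyK, potA, potB]
  generalize J1 w = j1, J2 w = j2, J3 w = j3
  obtain ⟨r, hr, hr'⟩ := exists_pos_cube_eq h0
  obtain ⟨s, hs, hs'⟩ := exists_pos_cube_eq h1
  obtain ⟨t, ht, ht'⟩ := exists_pos_cube_eq h2
  rw [← hr', ← hs', ← ht', ← mul_pow r, ← mul_pow (r * s), ← mul_pow s t]
  have e1 {y : ℝ} (hy : 0 < y) : (y ^ 3) ^ ((1 : ℝ) / 3) = y := by
    simpa using cube_rpow_div_three hy 1
  have e2 {y : ℝ} (hy : 0 < y) : (y ^ 3) ^ ((2 : ℝ) / 3) = y ^ 2 := by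
    simpa using cube_rpow_div_three hy 2
  have e4 {y : ℝ} (hy : 0 < y) : (y ^ 3) ^ ((4 : ℝ) / 3) = y ^ 4 := by
    simpa using cube_rpow_div_three hy 4
  rw [e2 (by positivity), e4 (by positivity), e1 (by positivity), e2 (by positivity),
    e2 (by positivity), e4 hr]
  generalize hd : (((s ^ 3) ^ 2 - (t ^ 3) ^ 2)) = d
  rcases eq_or_ne d 0 with rfl | hd0
  · simp
    field_simp
    ring
  · clear hd
    field_simp
    ring

/-- `∂K/∂J₁`. -/
def polyK_J1 (j1 j2 j3 x1 x2 x3 α u : ℝ) : ℝ :=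
  2 * (j1 * j2 * j3 - α * (j1 * x2 * x3 + j2 * x1 * x3 + j3 * x1 * x2)) *
      (j2 * j3 - α * (x2 * x3)) +
    4 * u * x2 * x3 * j2 * j3 * j1 * x1 ^ 2 + 2 * u ^ 2 * (x1 * x2 * x3) ^ 2 * j1 * x1 ^ 2 -
    2 * α * u * x2 * x3 * (2 * j1 * x1 ^ 2 * (x2 * x3) + x1 ^ 3 * (j2 * x3 + j3 * x2))

/-- `∂K/∂J₂`; by symmetry, `∂K/∂J₃` is obtained by exchanging the indices `2` and `3`. -/
def polyK_J2 (j1 j2 j3 x1 x2 x3 α u : ℝ) : ℝ :=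
  2 * (j1 * j2 * j3 - α * (j1 * x2 * x3 + j2 * x1 * x3 + j3 * x1 * x2)) *
      (j1 * j3 - α * (x1 * x3)) +
    2 * u * x2 * x3 * j3 * (j1 ^ 2 * x1 ^ 2 + 4 * j2 * j3 * x2 * x3) +
    8 * u ^ 2 * (x1 * x2 * x3) ^ 2 * j3 * x2 * x3 -
    2 * α * u * x2 * x3 * (x1 ^ 3 * x3 * j1 -
      2 * j3 * (x1 ^ 2 * (x2 ^ 2 + x3 ^ 2) - 2 * (x2 * x3) ^ 2))

/-- `∂K/∂x₁` at fixed `α`, `u`. -/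
def polyK_x1 (j1 j2 j3 x1 x2 x3 α u : ℝ) : ℝ :=
  -2 * (j1 * j2 * j3 - α * (j1 * x2 * x3 + j2 * x1 * x3 + j3 * x1 * x2)) *
      (α * (j2 * x3 + j3 * x2)) +
    4 * u * x2 * x3 * j2 * j3 * j1 ^ 2 * x1 +
    u ^ 2 * (x2 * x3) ^ 2 * (4 * j1 ^ 2 * x1 ^ 3 + 16 * x1 * (j2 * j3 * x2 * x3)) -
    2 * α * u * x2 * x3 * (2 * j1 ^ 2 * x1 * (x2 * x3) +
      3 * x1 ^ 2 * (j2 * x3 + j3 * x2) * j1 - 4 * j2 * j3 * x1 * (x2 ^ 2 + x3 ^ 2)) +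
    4 * α ^ 2 * u * (x2 * x3) ^ 2 * (4 * x1 ^ 3 - 2 * x1 * (x2 ^ 2 + x3 ^ 2)) +
    4 * α * u ^ 2 * (x2 * x3) ^ 2 * (4 * x1 ^ 3 * (x2 ^ 2 + x3 ^ 2) - 4 * x1 * (x2 * x3) ^ 2) +
    16 * u ^ 3 * x1 ^ 3 * (x2 * x3) ^ 4

/-- `∂K/∂x₂` at fixed `α`, `u`; by symmetry, `∂K/∂x₃` is obtained by exchanging the indices
`2` and `3`. -/
def polyK_x2 (j1 j2 j3 x1 x2 x3 α u : ℝ) : ℝ :=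
  -2 * (j1 * j2 * j3 - α * (j1 * x2 * x3 + j2 * x1 * x3 + j3 * x1 * x2)) *
      (α * (j1 * x3 + j3 * x1)) +
    2 * u * x3 * j2 * j3 * (j1 ^ 2 * x1 ^ 2 + 4 * (j2 * j3 * (x2 * x3))) +
    u ^ 2 * (x1 * x3) ^ 2 * (2 * x2 * j1 ^ 2 * x1 ^ 2 + 24 * x2 ^ 2 * x3 * (j2 * j3)) -
    2 * α * u * (2 * j1 ^ 2 * x1 ^ 2 * x2 * x3 ^ 2 +
      x1 ^ 3 * j1 * (j2 * x3 ^ 2 + 2 * j3 * x2 * x3) -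
      2 * j2 * j3 * (x1 ^ 2 * (3 * x2 ^ 2 * x3 + x3 ^ 3) - 6 * x2 ^ 2 * x3 ^ 3)) +
    4 * α ^ 2 * u * (x1 ^ 2 - x3 ^ 2) * x3 ^ 2 * (2 * x1 ^ 2 * x2 - 4 * x2 ^ 3) +
    4 * α * u ^ 2 * (x1 * x3) ^ 2 *
      (4 * x1 ^ 2 * x2 ^ 3 + 2 * x1 ^ 2 * x2 * x3 ^ 2 - 8 * x2 ^ 3 * x3 ^ 2) +
    16 * u ^ 3 * x2 ^ 3 * (x1 * x3) ^ 4

/-- `∂K/∂α`. -/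
def polyK_α (j1 j2 j3 x1 x2 x3 α u : ℝ) : ℝ :=
  -2 * (j1 * j2 * j3 - α * (j1 * x2 * x3 + j2 * x1 * x3 + j3 * x1 * x2)) *
      (j1 * x2 * x3 + j2 * x1 * x3 + j3 * x1 * x2) -
    2 * u * x2 * x3 * (j1 ^ 2 * x1 ^ 2 * (x2 * x3) + x1 ^ 3 * ((j2 * x3 + j3 * x2) * j1) -
      2 * (j2 * j3 * (x1 ^ 2 * (x2 ^ 2 + x3 ^ 2) - 2 * (x2 * x3) ^ 2))) +
    8 * α * u * ((x1 ^ 2 - x2 ^ 2) * (x1 ^ 2 - x3 ^ 2) * (x2 * x3) ^ 2) +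
    4 * u ^ 2 * ((x1 * x2 * x3) ^ 2 * (x1 ^ 2 * (x2 ^ 2 + x3 ^ 2) - 2 * (x2 * x3) ^ 2))

/-- `∂K/∂u`. -/
def polyK_u (j1 j2 j3 x1 x2 x3 α u : ℝ) : ℝ :=
  2 * x2 * x3 * j2 * j3 * (j1 ^ 2 * x1 ^ 2 + 2 * (j2 * j3 * (x2 * x3))) +
    2 * u * (x1 * x2 * x3) ^ 2 * (j1 ^ 2 * x1 ^ 2 + 8 * (j2 * j3 * (x2 * x3))) -
    2 * α * x2 * x3 * (j1 ^ 2 * x1 ^ 2 * (x2 * x3) + x1 ^ 3 * ((j2 * x3 + j3 * x2) * j1) -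
      2 * (j2 * j3 * (x1 ^ 2 * (x2 ^ 2 + x3 ^ 2) - 2 * (x2 * x3) ^ 2))) +
    4 * α ^ 2 * ((x1 ^ 2 - x2 ^ 2) * (x1 ^ 2 - x3 ^ 2) * (x2 * x3) ^ 2) +
    8 * α * u * ((x1 * x2 * x3) ^ 2 * (x1 ^ 2 * (x2 ^ 2 + x3 ^ 2) - 2 * (x2 * x3) ^ 2)) +
    12 * u ^ 2 * (x1 * x2 * x3) ^ 4

section PolyDeriv

variable {E : Type*} [NormedAddCommGroup E] [NormedSpace ℝ E] {z : E}
  {j1 j2 j3 x1 x2 x3 α u : E → ℝ} {j1' j2' j3' x1' x2' x3' α' u' : E →L[ℝ] ℝ}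

lemma HasFDerivAt.polyH (hj1 : HasFDerivAt j1 j1' z) (hj2 : HasFDerivAt j2 j2' z)
    (hj3 : HasFDerivAt j3 j3' z) (hx2 : HasFDerivAt x2 x2' z) (hx3 : HasFDerivAt x3 x3' z)
    (hα : HasFDerivAt α α' z) (hu : HasFDerivAt u u' z) :
    HasFDerivAt (fun w => polyH (j1 w) (j2 w) (j3 w) (x2 w) (x3 w) (α w) (u w))
      ((2 * j1 z) • j1' + (2 * j2 z) • j2' + (2 * j3 z) • j3' + (2 * u z * x2 z) • x2' +
        (2 * u z * x3 z) • x3' + α' + (x2 z ^ 2 + x3 z ^ 2) • u') z := by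
  have h := ((((hj1.pow 2).add (hj2.pow 2)).add (hj3.pow 2)).add hα).add
    (hu.mul ((hx2.pow 2).add (hx3.pow 2)))
  refine h.congr_fderiv ?_
  ext v
  simp
  ring

lemma HasFDerivAt.polyK (hj1 : HasFDerivAt j1 j1' z) (hj2 : HasFDerivAt j2 j2' z)
    (hj3 : HasFDerivAt j3 j3' z) (hx1 : HasFDerivAt x1 x1' z) (hx2 : HasFDerivAt x2 x2' z)
    (hx3 : HasFDerivAt x3 x3' z) (hα : HasFDerivAt α α' z) (hu : HasFDerivAt u u' z) :
    HasFDerivAt (fun w => polyK (j1 w) (j2 w) (j3 w) (x1 w) (x2 w) (x3 w) (α w) (u w))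
      (polyK_J1 (j1 z) (j2 z) (j3 z) (x1 z) (x2 z) (x3 z) (α z) (u z) • j1' +
        polyK_J2 (j1 z) (j2 z) (j3 z) (x1 z) (x2 z) (x3 z) (α z) (u z) • j2' +
        polyK_J2 (j1 z) (j3 z) (j2 z) (x1 z) (x3 z) (x2 z) (α z) (u z) • j3' +
        polyK_x1 (j1 z) (j2 z) (j3 z) (x1 z) (x2 z) (x3 z) (α z) (u z) • x1' +
        polyK_x2 (j1 z) (j2 z) (j3 z) (x1 z) (x2 z) (x3 z) (α z) (u z) • x2' +
        polyK_x2 (j1 z) (j3 z) (j2 z) (x1 z) (x3 z) (x2 z) (α z) (u z) • x3' +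
        polyK_α (j1 z) (j2 z) (j3 z) (x1 z) (x2 z) (x3 z) (α z) (u z) • α' +
        polyK_u (j1 z) (j2 z) (j3 z) (x1 z) (x2 z) (x3 z) (α z) (u z) • u') z := by
  have hX := (hx1.mul hx2).mul hx3
  have hY := hx2.mul hx3
  have hjj := hj2.mul hj3
  have hS := (((hj1.mul hx2).mul hx3).add ((hj2.mul hx1).mul hx3)).add ((hj3.mul hx1).mul hx2)
  have hjx := (hj1.pow 2).mul (hx1.pow 2)
  have hjjY := hjj.mul hY
  have hQ := ((hx1.pow 2).mul ((hx2.pow 2).add (hx3.pow 2))).sub ((hY.pow 2).const_mul 2)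
  have hM := ((hjx.mul hY).add ((hx1.pow 3).mul (((hj2.mul hx3).add (hj3.mul hx2)).mul hj1))).sub
    ((hjj.mul hQ).const_mul 2)
  have h := ((((((((((hj1.mul hj2).mul hj3).sub (hα.mul hS)).pow 2).add
    ((hu.mul (hY.mul (hjj.mul (hjx.add (hjjY.const_mul 2))))).const_mul 2)).add
    ((hu.pow 2).mul ((hX.pow 2).mul (hjx.add (hjjY.const_mul 8))))).sub
    (((hα.mul hu).mul (hY.mul hM)).const_mul 2)).add
    ((((hα.pow 2).mul hu).mul ((((hx1.pow 2).sub (hx2.pow 2)).mul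
      ((hx1.pow 2).sub (hx3.pow 2))).mul (hY.pow 2))).const_mul 4)).add
    (((hα.mul (hu.pow 2)).mul ((hX.pow 2).mul hQ)).const_mul 4)).add
    (((hu.pow 3).mul (hX.pow 4)).const_mul 4))
  refine (h.congr_fderiv ?_).congr_of_eventuallyEq (.of_forall fun w => ?_)
  · ext v
    simp [polyK_J1, polyK_J2, polyK_x1, polyK_x2, polyK_α, polyK_u]
    ring
  · simp [_root_.polyK]

end PolyDeriv

/-- The gradient of the potential of `H`, where `α = γx₁x₂x₃` and `u = κ(x₂² − x₃²)`. -/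
def gradV (x1 x2 x3 γ κ : ℝ) : Fin 3 → ℝ :=
  ![-(2 / 3) * γ * (x2 * x3),
    -(2 / 3) * γ * (x1 * x3) - 2 * κ * x2 * (x2 ^ 2 + 3 * x3 ^ 2),
    -(2 / 3) * γ * (x1 * x2) + 2 * κ * x3 * (3 * x2 ^ 2 + x3 ^ 2)]

/-- The gradient of `K` in `J`, where `α = γx₁x₂x₃` and `u = κ(x₂² − x₃²)`. -/
def gradKJ (j1 j2 j3 x1 x2 x3 γ κ : ℝ) : Fin 3 → ℝ :=
  ![polyK_J1 j1 j2 j3 x1 x2 x3 (γ * (x1 * x2 * x3)) (κ * (x2 ^ 2 - x3 ^ 2)),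
    polyK_J2 j1 j2 j3 x1 x2 x3 (γ * (x1 * x2 * x3)) (κ * (x2 ^ 2 - x3 ^ 2)),
    polyK_J2 j1 j3 j2 x1 x3 x2 (γ * (x1 * x2 * x3)) (κ * (x2 ^ 2 - x3 ^ 2))]

/-- The gradient of `K` in `x`, where `α = γx₁x₂x₃` and `u = κ(x₂² − x₃²)`. -/
def gradKx (j1 j2 j3 x1 x2 x3 γ κ : ℝ) : Fin 3 → ℝ :=
  ![polyK_x1 j1 j2 j3 x1 x2 x3 (γ * (x1 * x2 * x3)) (κ * (x2 ^ 2 - x3 ^ 2)) -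
      2 / 3 * γ * (x2 * x3) *
        polyK_α j1 j2 j3 x1 x2 x3 (γ * (x1 * x2 * x3)) (κ * (x2 ^ 2 - x3 ^ 2)),
    polyK_x2 j1 j2 j3 x1 x2 x3 (γ * (x1 * x2 * x3)) (κ * (x2 ^ 2 - x3 ^ 2)) -
      2 / 3 * γ * (x1 * x3) *
        polyK_α j1 j2 j3 x1 x2 x3 (γ * (x1 * x2 * x3)) (κ * (x2 ^ 2 - x3 ^ 2)) -
      4 * κ * x2 *
        polyK_u j1 j2 j3 x1 x2 x3 (γ * (x1 * x2 * x3)) (κ * (x2 ^ 2 - x3 ^ 2)),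
    polyK_x2 j1 j3 j2 x1 x3 x2 (γ * (x1 * x2 * x3)) (κ * (x2 ^ 2 - x3 ^ 2)) -
      2 / 3 * γ * (x1 * x2) *
        polyK_α j1 j2 j3 x1 x2 x3 (γ * (x1 * x2 * x3)) (κ * (x2 ^ 2 - x3 ^ 2)) +
      4 * κ * x3 *
        polyK_u j1 j2 j3 x1 x2 x3 (γ * (x1 * x2 * x3)) (κ * (x2 ^ 2 - x3 ^ 2))]

/-- The `e(3)` Lie–Poisson bracket of `H`, with its potential multiplied by `|x|²`, and `K`
vanishes on `x · J = 0`. -/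
lemma e3_bracket_eq_zero (j1 j2 j3 x1 x2 x3 γ κ : ℝ) (hx1 : x1 ≠ 0)
    (h : x1 * j1 + x2 * j2 + x3 * j3 = 0) {A B C D : Fin 3 → ℝ}
    (hA : A = ![2 * j1, 2 * j2, 2 * j3])
    (hB : B = (x1 ^ 2 + x2 ^ 2 + x3 ^ 2) • gradV x1 x2 x3 γ κ)
    (hC : C = gradKJ j1 j2 j3 x1 x2 x3 γ κ) (hD : D = gradKx j1 j2 j3 x1 x2 x3 γ κ) :
    j1 * (A 1 * C 2 - A 2 * C 1) + j2 * (A 2 * C 0 - A 0 * C 2) +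
      j3 * (A 0 * C 1 - A 1 * C 0) +
    x1 * (A 1 * D 2 - A 2 * D 1 + B 1 * C 2 - B 2 * C 1) +
    x2 * (A 2 * D 0 - A 0 * D 2 + B 2 * C 0 - B 0 * C 2) +
    x3 * (A 0 * D 1 - A 1 * D 0 + B 0 * C 1 - B 1 * C 0) = 0 := by
  obtain ⟨m2, rfl⟩ : ∃ m, j2 = x1 * m := ⟨j2 / x1, by field_simp⟩
  obtain ⟨m3, rfl⟩ : ∃ m, j3 = x1 * m := ⟨j3 / x1, by field_simp⟩
  obtain rfl : j1 = -(x2 * m2 + x3 * m3) :=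
    mul_left_cancel₀ hx1 (by linear_combination h)
  subst hA hB hC hD
  simp only [gradV, gradKJ, gradKx, polyK_J1, polyK_J2, polyK_x1, polyK_x2, polyK_α, polyK_u,
    Matrix.cons_val_zero, Matrix.cons_val_one, Matrix.cons_val, Pi.smul_apply, smul_eq_mul]
  ring

/-- the Gaffet system with vorticity: the Hamiltonian H and the
sextic invariant K = K₆ + K₄ + K₂ + K₀ are in involution with respect to the
sphere Dirac bracket on T*S², in the positive octant with x₂² ≠ x₃². -/
theorem gaffet_vorticity_sphere_involution
    (a b : ℝ) (z : Phase)
    (h1 : z.1 0 ^ 2 + z.1 1 ^ 2 + z.1 2 ^ 2 = 1)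
    (h2 : z.1 0 * z.2 0 + z.1 1 * z.2 1 + z.1 2 * z.2 2 = 0)
    (hx1 : 0 < z.1 0) (hx2 : 0 < z.1 1) (hx3 : 0 < z.1 2)
    (hx23 : z.1 1 ^ 2 ≠ z.1 2 ^ 2) :
    diracS
      (fun w => J1 w ^ 2 + J2 w ^ 2 + J3 w ^ 2 +
        a ^ 2 / (w.1 0 * w.1 1 * w.1 2) ^ ((2 : ℝ) / 3) +
        b ^ 2 * (w.1 1 ^ 2 + w.1 2 ^ 2) / (w.1 1 ^ 2 - w.1 2 ^ 2) ^ 2)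
      (fun w => GK6 w + GK4 a b w + GK2 a b w + GK0 a b w) z = 0 := by
  have hJ1 := hasFDerivAt_J1 z
  have hJ2 := hasFDerivAt_J2 z
  have hJ3 := hasFDerivAt_J3 z
  have hX1 := hasFDerivAt_x 0 z
  have hX2 := hasFDerivAt_x 1 z
  have hX3 := hasFDerivAt_x 2 z
  have hα := hasFDerivAt_potA a hx1 hx2 hx3
  have hu := hasFDerivAt_potB b hx23
  have hH := hJ1.polyH hJ2 hJ3 hX2 hX3 hα hu
  have hK := (hJ1.polyK hJ2 hJ3 hX1 hX2 hX3 hα hu).congr_of_eventuallyEq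
    (f₁ := fun w => GK6 w + GK4 a b w + GK2 a b w + GK0 a b w) (by
      filter_upwards [hX1.continuousAt.eventually (lt_mem_nhds hx1),
        hX2.continuousAt.eventually (lt_mem_nhds hx2),
        hX3.continuousAt.eventually (lt_mem_nhds hx3)] with w h₁ h₂ h₃
      exact GK_eq_polyK a b h₁ h₂ h₃)
  have hX : z.1 0 * z.1 1 * z.1 2 ≠ 0 := by positivity
  have hd : z.1 1 ^ 2 - z.1 2 ^ 2 ≠ 0 := sub_ne_zero.mpr hx23
  obtain ⟨γ, hγ⟩ : ∃ γ, potA a z = γ * (z.1 0 * z.1 1 * z.1 2) :=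
    ⟨potA a z / (z.1 0 * z.1 1 * z.1 2), by field_simp⟩
  obtain ⟨κ, hκ⟩ : ∃ κ, potB b z = κ * (z.1 1 ^ 2 - z.1 2 ^ 2) :=
    ⟨potB b z / (z.1 1 ^ 2 - z.1 2 ^ 2), by field_simp⟩
  have hf : HasFDerivAt (fun w => J1 w ^ 2 + J2 w ^ 2 + J3 w ^ 2 +
        a ^ 2 / (w.1 0 * w.1 1 * w.1 2) ^ ((2 : ℝ) / 3) +
        b ^ 2 * (w.1 1 ^ 2 + w.1 2 ^ 2) / (w.1 1 ^ 2 - w.1 2 ^ 2) ^ 2)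
      (covec ![2 * J1 z, 2 * J2 z, 2 * J3 z]
        ((z.1 0 ^ 2 + z.1 1 ^ 2 + z.1 2 ^ 2) •
          gradV (z.1 0) (z.1 1) (z.1 2) γ κ) z) z := by
    refine (hH.congr_fderiv ?_).congr_of_eventuallyEq (.of_forall fun w => ?_)
    · rw [h1, one_smul, hγ, hκ, mul_div_assoc, mul_div_cancel_right₀ _ hX,
        mul_div_assoc, mul_div_cancel_right₀ _ hd]
      ext v <;> simp [covec, gradV]
      ring
    · simp only [polyH, potA, potB]
      ring
  have hg := hK.congr_fderiv (g' := covec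
    (gradKJ (J1 z) (J2 z) (J3 z) (z.1 0) (z.1 1) (z.1 2) γ κ)
    (gradKx (J1 z) (J2 z) (J3 z) (z.1 0) (z.1 1) (z.1 2) γ κ) z) (by
      simp only [hγ, hκ]
      rw [mul_div_assoc, mul_div_cancel_right₀ _ hX, mul_div_assoc, mul_div_cancel_right₀ _ hd]
      ext v <;> simp [covec, gradKJ, gradKx]
      ring)
  rw [diracS_of_hasFDerivAt hf hg]
  have hJx : z.1 0 * J1 z + z.1 1 * J2 z + z.1 2 * J3 z = 0 := by
    simp only [J1, J2, J3]
    ring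
  exact e3_bracket_eq_zero (J1 z) (J2 z) (J3 z) (z.1 0) (z.1 1) (z.1 2) γ κ hx1.ne' hJx
    rfl rfl rfl rfl
end
end

section
/- Let a₁, a₂, a₃ be positive real numbers, c a real number, and let {·,·}_D be the Dirac bracket on ℝ³×ℝ³ associated with F₁ = x₁²/a₁ + x₂²/a₂ + x₃²/a₃ − 1 and F₂ = x₁p₁/a₁ + x₂p₂/a₂ + x₃p₃/a₃. Define y₁ = x₁/√a₁, y₂ = x₂/√a₂, y₃ = x₃/√a₃ and L₁ = (a₃p₃x₂ − a₂p₂x₃)/(√a₂√a₃), L₂ = (a₁p₁x₃ − a₃p₃x₁)/(√a₁√a₃), L₃ = (a₂p₂x₁ − a₁p₁x₂)/(√a₁√a₂), and set H = L₁² + L₂² + (4/3)L₃² − c y₁/(2 y₃^{2/3}) and K = L₃(L₁² + L₂² + (8/9)L₃²) + c(3L₁y₃ − 2L₃y₁)/(4 y₃^{2/3}). Then {H, K}_D = 0 at every point of the constraint surface (where F₁ = 0 and F₂ = 0) with x₃ > 0. (This is the Goryachev system on the ellipsoid.) -/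
noncomputable section

/-- Ellipsoid/hyperboloid constraint F₁ = x₁²/a₁ + x₂²/a₂ + x₃²/a₃ − 1. -/
noncomputable def ellF₁ (a₁ a₂ a₃ : ℝ) : Phase → ℝ := fun z =>
  z.1 0 ^ 2 / a₁ + z.1 1 ^ 2 / a₂ + z.1 2 ^ 2 / a₃ - 1

/-- Ellipsoid/hyperboloid constraint F₂ = x₁p₁/a₁ + x₂p₂/a₂ + x₃p₃/a₃. -/
noncomputable def ellF₂ (a₁ a₂ a₃ : ℝ) : Phase → ℝ := fun z =>
  z.1 0 * z.2 0 / a₁ + z.1 1 * z.2 1 / a₂ + z.1 2 * z.2 2 / a₃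

/-- Dirac bracket {·,·}_D on the ellipsoid/hyperboloid. -/
noncomputable def diracE (a₁ a₂ a₃ : ℝ) (f g : Phase → ℝ) (z : Phase) : ℝ :=
  dirac (ellF₁ a₁ a₂ a₃) (ellF₂ a₁ a₂ a₃) f g z

/-- y₁ = x₁/√a₁. -/
noncomputable def y1 (a₁ a₂ a₃ : ℝ) : Phase → ℝ := fun z => z.1 0 / Real.sqrt a₁
/-- y₂ = x₂/√a₂. -/
noncomputable def y2 (a₁ a₂ a₃ : ℝ) : Phase → ℝ := fun z => z.1 1 / Real.sqrt a₂
/-- y₃ = x₃/√a₃. -/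
noncomputable def y3 (a₁ a₂ a₃ : ℝ) : Phase → ℝ := fun z => z.1 2 / Real.sqrt a₃

/-- L₁ = (a₃p₃x₂ − a₂p₂x₃)/(√a₂√a₃). -/
noncomputable def L1 (a₁ a₂ a₃ : ℝ) : Phase → ℝ := fun z =>
  (a₃ * z.2 2 * z.1 1 - a₂ * z.2 1 * z.1 2) / (Real.sqrt a₂ * Real.sqrt a₃)
/-- L₂ = (a₁p₁x₃ − a₃p₃x₁)/(√a₁√a₃). -/
noncomputable def L2 (a₁ a₂ a₃ : ℝ) : Phase → ℝ := fun z =>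
  (a₁ * z.2 0 * z.1 2 - a₃ * z.2 2 * z.1 0) / (Real.sqrt a₁ * Real.sqrt a₃)
/-- L₃ = (a₂p₂x₁ − a₁p₁x₂)/(√a₁√a₂). -/
noncomputable def L3 (a₁ a₂ a₃ : ℝ) : Phase → ℝ := fun z =>
  (a₂ * z.2 1 * z.1 0 - a₁ * z.2 0 * z.1 1) / (Real.sqrt a₁ * Real.sqrt a₂)

/-- The differential of the position coordinate `x i`. -/
def dPos (i : Fin 3) : Phase →L[ℝ] ℝ :=
  (ContinuousLinearMap.proj i).comp (ContinuousLinearMap.fst ℝ (Fin 3 → ℝ) (Fin 3 → ℝ))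

/-- The differential of the momentum coordinate `p i`. -/
def dMom (i : Fin 3) : Phase →L[ℝ] ℝ :=
  (ContinuousLinearMap.proj i).comp (ContinuousLinearMap.snd ℝ (Fin 3 → ℝ) (Fin 3 → ℝ))

lemma dPos_apply (i : Fin 3) (v : Phase) : dPos i v = v.1 i := rfl

lemma dMom_apply (i : Fin 3) (v : Phase) : dMom i v = v.2 i := rfl

lemma hasFDerivAt_pos (i : Fin 3) (z : Phase) :
    HasFDerivAt (fun w : Phase => w.1 i) (dPos i) z := (dPos i).hasFDerivAt

lemma hasFDerivAt_mom (i : Fin 3) (z : Phase) :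
    HasFDerivAt (fun w : Phase => w.2 i) (dMom i) z := (dMom i).hasFDerivAt

lemma hasFDerivAt_ellF₁ (a₁ a₂ a₃ : ℝ) (z : Phase) :
    HasFDerivAt (ellF₁ a₁ a₂ a₃) ((2 * z.1 0 / a₁) • dPos 0 + (2 * z.1 1 / a₂) • dPos 1 +
      (2 * z.1 2 / a₃) • dPos 2) z := by
  have h := (((((hasFDerivAt_pos 0 z).pow 2).mul_const a₁⁻¹).add
    (((hasFDerivAt_pos 1 z).pow 2).mul_const a₂⁻¹)).add
    (((hasFDerivAt_pos 2 z).pow 2).mul_const a₃⁻¹)).sub_const 1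
  refine h.congr_fderiv ?_
  ext v <;> simp [dPos_apply]
  ring

lemma hasFDerivAt_L1 (a₁ a₂ a₃ : ℝ) (z : Phase) :
    HasFDerivAt (L1 a₁ a₂ a₃) ((√a₂ * √a₃)⁻¹ •
      (a₃ • (z.2 2 • dPos 1 + z.1 1 • dMom 2) - a₂ • (z.2 1 • dPos 2 + z.1 2 • dMom 1))) z := by
  have h := ((((hasFDerivAt_mom 2 z).const_mul a₃).mul (hasFDerivAt_pos 1 z)).sub
    (((hasFDerivAt_mom 1 z).const_mul a₂).mul (hasFDerivAt_pos 2 z))).mul_const (√a₂ * √a₃)⁻¹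
  refine h.congr_fderiv ?_
  module

lemma hasFDerivAt_L2 (a₁ a₂ a₃ : ℝ) (z : Phase) :
    HasFDerivAt (L2 a₁ a₂ a₃) ((√a₁ * √a₃)⁻¹ •
      (a₁ • (z.2 0 • dPos 2 + z.1 2 • dMom 0) - a₃ • (z.2 2 • dPos 0 + z.1 0 • dMom 2))) z := by
  have h := ((((hasFDerivAt_mom 0 z).const_mul a₁).mul (hasFDerivAt_pos 2 z)).sub
    (((hasFDerivAt_mom 2 z).const_mul a₃).mul (hasFDerivAt_pos 0 z))).mul_const (√a₁ * √a₃)⁻¹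
  refine h.congr_fderiv ?_
  module

lemma hasFDerivAt_L3 (a₁ a₂ a₃ : ℝ) (z : Phase) :
    HasFDerivAt (L3 a₁ a₂ a₃) ((√a₁ * √a₂)⁻¹ •
      (a₂ • (z.2 1 • dPos 0 + z.1 0 • dMom 1) - a₁ • (z.2 0 • dPos 1 + z.1 1 • dMom 0))) z := by
  have h := ((((hasFDerivAt_mom 1 z).const_mul a₂).mul (hasFDerivAt_pos 0 z)).sub
    (((hasFDerivAt_mom 0 z).const_mul a₁).mul (hasFDerivAt_pos 1 z))).mul_const (√a₁ * √a₂)⁻¹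
  refine h.congr_fderiv ?_
  module

lemma hasFDerivAt_y1 (a₁ a₂ a₃ : ℝ) (z : Phase) :
    HasFDerivAt (y1 a₁ a₂ a₃) ((√a₁)⁻¹ • dPos 0) z :=
  (hasFDerivAt_pos 0 z).mul_const (√a₁)⁻¹

lemma hasFDerivAt_y3 (a₁ a₂ a₃ : ℝ) (z : Phase) :
    HasFDerivAt (y3 a₁ a₂ a₃) ((√a₃)⁻¹ • dPos 2) z :=
  (hasFDerivAt_pos 2 z).mul_const (√a₃)⁻¹

lemma hasFDerivAt_inv_rpow_two_thirds {g : Phase → ℝ} {g' : Phase →L[ℝ] ℝ} {z : Phase}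
    (hg : HasFDerivAt g g' z) (hpos : 0 < g z) :
    HasFDerivAt (fun w => (g w ^ ((2 : ℝ) / 3))⁻¹)
      (-(2 / 3 * (g z ^ ((2 : ℝ) / 3))⁻¹ / g z) • g') z := by
  have hu : g z ^ ((2 : ℝ) / 3) ≠ 0 := (Real.rpow_pos_of_pos hpos _).ne'
  have h := (hasDerivAt_inv hu).comp_hasFDerivAt z
    (hg.rpow_const (p := (2 : ℝ) / 3) (Or.inl hpos.ne'))
  refine h.congr_fderiv ?_
  rw [Real.rpow_sub_one hpos.ne', smul_smul]
  congr 1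
  field_simp

section GoryachevFunctions

variable {f₁ f₂ f₃ g₁ g₃ : Phase → ℝ} {f₁' f₂' f₃' g₁' g₃' : Phase →L[ℝ] ℝ} {z : Phase}

lemma hasFDerivAt_goryachevH (c : ℝ) (hf₁ : HasFDerivAt f₁ f₁' z) (hf₂ : HasFDerivAt f₂ f₂' z)
    (hf₃ : HasFDerivAt f₃ f₃' z) (hg₁ : HasFDerivAt g₁ g₁' z) (hg₃ : HasFDerivAt g₃ g₃' z)
    (hpos : 0 < g₃ z) :
    HasFDerivAt
      (fun w => f₁ w ^ 2 + f₂ w ^ 2 + (4 / 3 : ℝ) * f₃ w ^ 2 -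
        c * g₁ w / (2 * g₃ w ^ ((2 : ℝ) / 3)))
      ((2 * f₁ z) • f₁' + (2 * f₂ z) • f₂' + (8 / 3 * f₃ z) • f₃' -
        (c / 2 * (g₃ z ^ ((2 : ℝ) / 3))⁻¹) • (g₁' - (2 / 3 * g₁ z / g₃ z) • g₃')) z := by
  have h := (((hf₁.mul hf₁).add (hf₂.mul hf₂)).add ((hf₃.mul hf₃).const_mul (4 / 3 : ℝ))).sub
    ((hg₁.mul (hasFDerivAt_inv_rpow_two_thirds hg₃ hpos)).const_mul (c / 2))
  refine (h.congr_fderiv ?_).congr_of_eventuallyEq (.of_eq (funext fun w => ?_))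
  · module
  · simp only [Pi.add_apply, Pi.sub_apply, Pi.mul_apply]
    ring

lemma hasFDerivAt_goryachevK (c : ℝ) (hf₁ : HasFDerivAt f₁ f₁' z) (hf₂ : HasFDerivAt f₂ f₂' z)
    (hf₃ : HasFDerivAt f₃ f₃' z) (hg₁ : HasFDerivAt g₁ g₁' z) (hg₃ : HasFDerivAt g₃ g₃' z)
    (hpos : 0 < g₃ z) :
    HasFDerivAt
      (fun w => f₃ w * (f₁ w ^ 2 + f₂ w ^ 2 + (8 / 9 : ℝ) * f₃ w ^ 2) +
        c * (3 * f₁ w * g₃ w - 2 * f₃ w * g₁ w) / (4 * g₃ w ^ ((2 : ℝ) / 3)))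
      ((2 * f₁ z * f₃ z) • f₁' + (2 * f₂ z * f₃ z) • f₂' +
        (f₁ z ^ 2 + f₂ z ^ 2 + 8 / 3 * f₃ z ^ 2) • f₃' +
        (c / 4 * (g₃ z ^ ((2 : ℝ) / 3))⁻¹) •
          ((3 * g₃ z) • f₁' - (2 * g₁ z) • f₃' - (2 * f₃ z) • g₁' + (3 * f₁ z) • g₃' -
            (2 / 3 * (3 * f₁ z * g₃ z - 2 * f₃ z * g₁ z) / g₃ z) • g₃')) z := by
  have h := (hf₃.mul (((hf₁.mul hf₁).add (hf₂.mul hf₂)).add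
      ((hf₃.mul hf₃).const_mul (8 / 9 : ℝ)))).add
    (((((hf₁.mul hg₃).const_mul 3).sub ((hf₃.mul hg₁).const_mul 2)).mul
      (hasFDerivAt_inv_rpow_two_thirds hg₃ hpos)).const_mul (c / 4))
  refine (h.congr_fderiv ?_).congr_of_eventuallyEq (.of_eq (funext fun w => ?_))
  · simp only [Pi.add_apply, Pi.sub_apply, Pi.mul_apply]
    module
  · simp only [Pi.add_apply, Pi.sub_apply, Pi.mul_apply]
    ring

end GoryachevFunctions

lemma pb_eq_of_hasFDerivAt {f g : Phase → ℝ} {f' g' : Phase →L[ℝ] ℝ} {z : Phase}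
    (hf : HasFDerivAt f f' z) (hg : HasFDerivAt g g' z) :
    pb f g z = ∑ i : Fin 3,
      (f' (Pi.single i 1, 0) * g' (0, Pi.single i 1) -
        f' (0, Pi.single i 1) * g' (Pi.single i 1, 0)) := by
  rw [pb, hf.fderiv, hg.fderiv]

lemma dirac_eq_pb {F₁ F₂ f g : Phase → ℝ} {z : Phase} (hf : pb F₁ f z = 0)
    (hg : pb F₁ g z = 0) : dirac F₁ F₂ f g z = pb f g z := by
  simp [dirac, hf, hg]

/-- the Goryachev system on the ellipsoid: H and K built from the
(y, L)-variables are in involution with respect to the Dirac bracket on the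
constraint surface with x₃ > 0. -/
theorem goryachev_ellipsoid_involution
    (a₁ a₂ a₃ : ℝ) (ha₁ : 0 < a₁) (ha₂ : 0 < a₂) (ha₃ : 0 < a₃) (c : ℝ)
    (z : Phase)
    (h1 : ellF₁ a₁ a₂ a₃ z = 0) (h2 : ellF₂ a₁ a₂ a₃ z = 0)
    (hx3 : 0 < z.1 2) :
    diracE a₁ a₂ a₃
      (fun w => L1 a₁ a₂ a₃ w ^ 2 + L2 a₁ a₂ a₃ w ^ 2 +
        (4 / 3 : ℝ) * L3 a₁ a₂ a₃ w ^ 2 -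
        c * y1 a₁ a₂ a₃ w / (2 * (y3 a₁ a₂ a₃ w) ^ ((2 : ℝ) / 3)))
      (fun w => L3 a₁ a₂ a₃ w *
          (L1 a₁ a₂ a₃ w ^ 2 + L2 a₁ a₂ a₃ w ^ 2 + (8 / 9 : ℝ) * L3 a₁ a₂ a₃ w ^ 2) +
        c * (3 * L1 a₁ a₂ a₃ w * y3 a₁ a₂ a₃ w - 2 * L3 a₁ a₂ a₃ w * y1 a₁ a₂ a₃ w) /
          (4 * (y3 a₁ a₂ a₃ w) ^ ((2 : ℝ) / 3))) z = 0 := by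
  obtain ⟨s₁, hs₁, rfl⟩ : ∃ s : ℝ, 0 < s ∧ s ^ 2 = a₁ :=
    ⟨√a₁, Real.sqrt_pos.2 ha₁, Real.sq_sqrt ha₁.le⟩
  obtain ⟨s₂, hs₂, rfl⟩ : ∃ s : ℝ, 0 < s ∧ s ^ 2 = a₂ :=
    ⟨√a₂, Real.sqrt_pos.2 ha₂, Real.sq_sqrt ha₂.le⟩
  obtain ⟨s₃, hs₃, rfl⟩ : ∃ s : ℝ, 0 < s ∧ s ^ 2 = a₃ :=
    ⟨√a₃, Real.sqrt_pos.2 ha₃, Real.sq_sqrt ha₃.le⟩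
  have hpos : 0 < y3 (s₁ ^ 2) (s₂ ^ 2) (s₃ ^ 2) z := div_pos hx3 (Real.sqrt_pos.2 ha₃)
  have hF := hasFDerivAt_ellF₁ (s₁ ^ 2) (s₂ ^ 2) (s₃ ^ 2) z
  have hL₁ := hasFDerivAt_L1 (s₁ ^ 2) (s₂ ^ 2) (s₃ ^ 2) z
  have hL₂ := hasFDerivAt_L2 (s₁ ^ 2) (s₂ ^ 2) (s₃ ^ 2) z
  have hL₃ := hasFDerivAt_L3 (s₁ ^ 2) (s₂ ^ 2) (s₃ ^ 2) z
  have hy₁ := hasFDerivAt_y1 (s₁ ^ 2) (s₂ ^ 2) (s₃ ^ 2) z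
  have hy₃ := hasFDerivAt_y3 (s₁ ^ 2) (s₂ ^ 2) (s₃ ^ 2) z
  have hH := hasFDerivAt_goryachevH c hL₁ hL₂ hL₃ hy₁ hy₃ hpos
  have hK := hasFDerivAt_goryachevK c hL₁ hL₂ hL₃ hy₁ hy₃ hpos
  have hu : y3 (s₁ ^ 2) (s₂ ^ 2) (s₃ ^ 2) z ^ ((2 : ℝ) / 3) ≠ 0 :=
    (Real.rpow_pos_of_pos hpos _).ne'
  rw [diracE, dirac_eq_pb]
  · rw [pb_eq_of_hasFDerivAt hH hK]
    generalize y3 (s₁ ^ 2) (s₂ ^ 2) (s₃ ^ 2) z ^ ((2 : ℝ) / 3) = u at hu ⊢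
    simp [Fin.sum_univ_three, dPos_apply, dMom_apply, L1, L2, L3, y1, y3, Real.sqrt_sq hs₁.le,
      Real.sqrt_sq hs₂.le, Real.sqrt_sq hs₃.le]
    field_simp
    ring
  · rw [pb_eq_of_hasFDerivAt hF hH]
    simp [Fin.sum_univ_three, dPos_apply, dMom_apply, Real.sqrt_sq hs₁.le,
      Real.sqrt_sq hs₂.le, Real.sqrt_sq hs₃.le]
    field_simp
    ring
  · rw [pb_eq_of_hasFDerivAt hF hK]
    simp [Fin.sum_univ_three, dPos_apply, dMom_apply, Real.sqrt_sq hs₁.le,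
      Real.sqrt_sq hs₂.le, Real.sqrt_sq hs₃.le]
    field_simp
    ring
end
end
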